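/- At the critical adsorption point z = 2, for every a ∈ (0,1), the staircase-polygon pressure satisfies lim_{n→∞} √n · P_n^S(2; 2⌊an/2⌋) = −3/(2·√(π·a·(1−a))); in particular lim_{n→∞} P_n^S(2; 2⌊an/2⌋) = 0. -/

import Mathlib

open Filter Real

/-- Partition function `C_n(z;j)` of a pair of mutually avoiding directed paths of length `2n`
(an adsorbing Dyck path below a directed path whose endpoint has height `2j+2`). -/
noncomputable def Cst (n j : ℕ) (z : ℝ) : ℝ :=
  ∑ m1 ∈ Finset.range (n + 1), ∑ m2 ∈ Finset.range (j + 1),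
    (((2 * (m2 : ℝ) + 1) * (2 * (m1 : ℝ) + 2 * j + 3) * ((m1 : ℝ) + m2 + j + 2) *
        ((m1 : ℝ) - m2 + j + 1)) /
      ((2 * (n : ℝ) + 1) * (2 * (n : ℝ) + 2) * (2 * (n : ℝ) + 3) ^ 2)) *
    (Nat.choose (2 * n + 3) (n + m2 + 2)) * (Nat.choose (2 * n + 3) (n + m1 + j + 3)) *
    (z - 1) ^ (m1 + m2)

/-- Partition function `Z_n^*(z;q) = Σ_{j=0}^{n} C_q(z;j)·C_{n−q}(z;j)` of grafted staircase
polygons constrained to pass through the visit `(q,0)`. -/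
noncomputable def Zstar (n q : ℕ) (z : ℝ) : ℝ :=
  ∑ j ∈ Finset.range (n + 1), Cst q j z * Cst (n - q) j z

/-- Staircase-polygon pressure `P_n^S(z;q) = log(1 − Z_n^*(z;q)/C_n(z;0))`. -/
noncomputable def PS (n q : ℕ) (z : ℝ) : ℝ :=
  Real.log (1 - Zstar n q z / Cst n 0 z)

theorem choose_absorb (n m : ℕ) :
    ((n : ℝ) + m + 2) * (2 * n + 2).choose (n + m + 2) =
      ((n : ℝ) + 1 - m) * (2 * n + 2).choose (n + m + 1) := by
  have h := Nat.choose_succ_right_eq (2 * n + 2) (n + m + 1)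
  rcases le_or_gt m (n + 1) with hm | hm
  · have h' : ((2 * n + 2 - (n + m + 1) : ℕ) : ℝ) = (n : ℝ) + 1 - m := by
      rw [Nat.cast_sub (by omega)]; push_cast; ring
    have h2 := congrArg (Nat.cast : ℕ → ℝ) h
    rw [Nat.cast_mul, Nat.cast_mul, h'] at h2
    push_cast at h2
    linear_combination h2
  · rw [Nat.choose_eq_zero_of_lt (by omega), Nat.choose_eq_zero_of_lt (by omega)]
    simp

open Finset in
theorem sum_odd_mul_choose (n s k : ℕ) :
    ∑ i ∈ range k, (2 * ((s + i : ℕ) : ℝ) + 1) * ((2 * n + 3).choose (n + (s + i) + 2) : ℝ) =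
      (2 * n + 3) *
        ((2 * n + 2).choose (n + s + 1) - (2 * n + 2).choose (n + (s + k) + 1) : ℝ) := by
  induction k with
  | zero => simp
  | succ k ih =>
    rw [sum_range_succ, ih]
    have h1 := Nat.choose_succ_succ' (2 * n + 2) (n + (s + k) + 1)
    have h2 := choose_absorb n (s + k)
    rw [show n + (s + (k + 1)) + 1 = n + (s + k) + 2 by ring,
      show (2 * n + 3).choose (n + (s + k) + 2) = _ from h1]
    push_cast at h2 ⊢
    linear_combination 2 * h2

open Finset in
theorem sum_odd_cube_mul_choose (n s k : ℕ) :
    ∑ i ∈ range k, (2 * ((s + i : ℕ) : ℝ) + 1) ^ 3 *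
        ((2 * n + 3).choose (n + (s + i) + 2) : ℝ) =
      (2 * n + 3) * ((4 * (s : ℝ) ^ 2 + 4 * n + 5) * (2 * n + 2).choose (n + s + 1) -
        (4 * ((s : ℝ) + k) ^ 2 + 4 * n + 5) * (2 * n + 2).choose (n + (s + k) + 1) : ℝ) := by
  induction k with
  | zero => simp
  | succ k ih =>
    rw [sum_range_succ, ih]
    have h1 := Nat.choose_succ_succ' (2 * n + 2) (n + (s + k) + 1)
    have h2 := choose_absorb n (s + k)
    rw [show n + (s + (k + 1)) + 1 = n + (s + k) + 2 by ring,
      show (2 * n + 3).choose (n + (s + k) + 2) = _ from h1]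
    push_cast at h2 ⊢
    linear_combination (2 * (2 * ((s : ℝ) + k) + 1) ^ 2 + 4 * (2 * n + 3)) * h2

open Finset in
/-- Closed form of the partition function at the critical point; both sums telescope. -/
theorem Cst_two (n j : ℕ) :
    Cst n j 2 = ((j : ℝ) + 1) ^ 2 * (2 * n + 2).choose (n + 1) * (2 * n + 2).choose (n + j + 2) /
      ((2 * n + 1) * (2 * n + 2)) := by
  have hx1 := sum_odd_mul_choose n 0 (j + 1)
  have hx3 := sum_odd_cube_mul_choose n 0 (j + 1)
  have hy1 := sum_odd_mul_choose n (j + 1) (n + 1)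
  have hy3 := sum_odd_cube_mul_choose n (j + 1) (n + 1)
  rw [Nat.choose_eq_zero_of_lt (show 2 * n + 2 < n + (j + 1 + (n + 1)) + 1 by omega)] at hy1 hy3
  set x : ℕ → ℝ := fun i => 2 * ((0 + i : ℕ) : ℝ) + 1 with hx
  set y : ℕ → ℝ := fun i => 2 * ((j + 1 + i : ℕ) : ℝ) + 1 with hy
  set u : ℕ → ℝ := fun i => (2 * n + 3).choose (n + (0 + i) + 2) with hu
  set v : ℕ → ℝ := fun i => (2 * n + 3).choose (n + (j + 1 + i) + 2) with hv
  have hsum : Cst n j 2 = ((∑ i ∈ range (n + 1), y i ^ 3 * v i) * (∑ i ∈ range (j + 1), x i * u i)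
      - (∑ i ∈ range (n + 1), y i * v i) * (∑ i ∈ range (j + 1), x i ^ 3 * u i)) /
      (4 * ((2 * (n : ℝ) + 1) * (2 * n + 2) * (2 * n + 3) ^ 2)) := by
    rw [sum_mul_sum, sum_mul_sum, ← sum_sub_distrib, sum_div]
    refine sum_congr rfl fun m1 _ => ?_
    rw [← sum_sub_distrib, sum_div]
    refine sum_congr rfl fun m2 _ => ?_
    simp only [hx, hy, hu, hv]
    rw [show n + (0 + m2) + 2 = n + m2 + 2 by ring,
      show n + (j + 1 + m1) + 2 = n + m1 + j + 3 by ring, show (2 : ℝ) - 1 = 1 by norm_num, one_pow]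
    push_cast
    field_simp
    ring
  rw [hsum, hx1, hx3, hy1, hy3, show n + (0 + (j + 1)) + 1 = n + j + 2 by ring,
    show n + (j + 1) + 1 = n + j + 2 by ring]
  push_cast
  field_simp
  ring_nf

open Finset in
/-- Vandermonde's identity for the central coefficient, folded at the middle. -/
theorem centralBinom_add_eq (q r k : ℕ) (hq : q ≤ k) (hr : r ≤ k) :
    (q + r).centralBinom = q.centralBinom * r.centralBinom +
      2 * ∑ j ∈ range k, (2 * q).choose (q + j + 1) * (2 * r).choose (r + j + 1) := by
  have h : (q + r).centralBinom =
      ∑ l ∈ range (q + (1 + r)), (2 * q).choose l * (2 * r).choose (q + r - l) := by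
    rw [Nat.centralBinom, show 2 * (q + r) = 2 * q + 2 * r by ring, Nat.add_choose_eq,
      Nat.sum_antidiagonal_eq_sum_range_succ_mk]
    rw [show (q + r).succ = q + (1 + r) by omega]
  have hlow : ∑ l ∈ range q, (2 * q).choose l * (2 * r).choose (q + r - l) =
      ∑ j ∈ range k, (2 * q).choose (q + j + 1) * (2 * r).choose (r + j + 1) := by
    rw [← sum_range_reflect, ← sum_subset (range_mono hq)]
    · refine sum_congr rfl fun j hj => ?_
      rw [mem_range] at hj
      rw [← Nat.choose_symm (show q + j + 1 ≤ 2 * q by omega)]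
      congr 2 <;> omega
    · intro j _ hj
      rw [mem_range] at hj
      rw [Nat.choose_eq_zero_of_lt (by omega), zero_mul]
  have hhigh : ∑ l ∈ range r, (2 * q).choose (q + (1 + l)) * (2 * r).choose (q + r - (q + (1 + l))) =
      ∑ j ∈ range k, (2 * q).choose (q + j + 1) * (2 * r).choose (r + j + 1) := by
    rw [← sum_subset (range_mono hr)]
    · refine sum_congr rfl fun j hj => ?_
      rw [mem_range] at hj
      rw [← Nat.choose_symm (show r + j + 1 ≤ 2 * r by omega)]
      congr 2 <;> omega
    · intro j _ hj
      rw [mem_range] at hj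
      rw [Nat.choose_eq_zero_of_lt (show 2 * r < _ by omega), mul_zero]
  rw [h, sum_range_add, sum_range_add, hlow, hhigh]
  simp [Nat.centralBinom]
  ring

theorem choose_two_mul_succ (q j : ℕ) :
    (((q : ℝ) + 1) ^ 2 - ((j : ℝ) + 1) ^ 2) * (2 * (q + 1)).choose (q + 1 + j + 1) =
      (2 * q + 2) * (2 * q + 1) * (2 * q).choose (q + j + 1) := by
  have h1 := congrArg (Nat.cast : ℕ → ℝ) (Nat.add_one_mul_choose_eq (2 * q + 1) (q + j + 1))
  have h2 := congrArg (Nat.cast : ℕ → ℝ) (Nat.choose_mul_succ_eq (2 * q) (q + j + 1))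
  rw [show 2 * (q + 1) = 2 * q + 1 + 1 by ring, show q + 1 + j + 1 = q + j + 1 + 1 by ring]
  rcases le_or_gt j q with hj | hj
  · have h3 : ((2 * q + 1 - (q + j + 1) : ℕ) : ℝ) = (q : ℝ) - j := by
      rw [Nat.cast_sub (by omega)]; push_cast; ring
    rw [Nat.cast_mul, Nat.cast_mul, h3] at h2
    push_cast at h1 h2
    linear_combination -((q : ℝ) - j) * h1 - (2 * (q : ℝ) + 2) * h2
  · rw [Nat.choose_eq_zero_of_lt (by omega), Nat.choose_eq_zero_of_lt (by omega)]
    simp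

theorem centralBinom_succ_cast (n : ℕ) :
    ((n + 1).centralBinom : ℝ) = 2 * (2 * n + 1) / (n + 1) * n.centralBinom := by
  have h := congrArg (Nat.cast : ℕ → ℝ) (Nat.succ_mul_centralBinom_succ n)
  push_cast at h
  field_simp
  linear_combination h

open Finset in
/-- Half of the fourth moment of `i ↦ C(2Q,Q+i) C(2R,R+i)`, where `Q = q + 1` and `R = r + 1`. -/
theorem sum_pow_four_mul_choose_mul_choose (q r k : ℕ) (hq : q + 1 ≤ k) (hr : r + 1 ≤ k) :
    ∑ j ∈ range k, ((j : ℝ) + 1) ^ 4 * (2 * (q + 1)).choose (q + 1 + j + 1) *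
        (2 * (r + 1)).choose (r + 1 + j + 1) =
      ((q + r).centralBinom : ℝ) * ((q + 1) * (r + 1) * (3 * (q + 1) * (r + 1) - (q + r + 2))) *
        2 / ((q + r + 1) * (q + r + 2)) := by
  have key (a b : ℕ) (ha : a ≤ k) (hb : b ≤ k) :
      ∑ j ∈ range k, ((2 * a).choose (a + j + 1) : ℝ) * (2 * b).choose (b + j + 1) =
        ((a + b).centralBinom - a.centralBinom * b.centralBinom : ℝ) / 2 := by
    have := congrArg (Nat.cast : ℕ → ℝ) (centralBinom_add_eq a b k ha hb)
    push_cast at this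
    linear_combination -this / 2
  have hsplit : ∑ j ∈ range k, ((j : ℝ) + 1) ^ 4 * (2 * (q + 1)).choose (q + 1 + j + 1) *
        (2 * (r + 1)).choose (r + 1 + j + 1) =
      ((2 * q + 2) * (2 * q + 1) * ((2 * r + 2) * (2 * r + 1))) *
          ∑ j ∈ range k, ((2 * q).choose (q + j + 1) : ℝ) * (2 * r).choose (r + j + 1) -
        (((q : ℝ) + 1) ^ 2 + ((r : ℝ) + 1) ^ 2) * ((2 * q + 2) * (2 * q + 1)) *
          ∑ j ∈ range k, ((2 * q).choose (q + j + 1) : ℝ) *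
            (2 * (r + 1)).choose (r + 1 + j + 1) +
        ((q : ℝ) + 1) ^ 4 *
          ∑ j ∈ range k, ((2 * (q + 1)).choose (q + 1 + j + 1) : ℝ) *
            (2 * (r + 1)).choose (r + 1 + j + 1) := by
    rw [mul_sum, mul_sum, mul_sum, ← sum_sub_distrib, ← sum_add_distrib]
    refine sum_congr rfl fun j _ => ?_
    have h1 := choose_two_mul_succ q j
    have h2 := choose_two_mul_succ r j
    rw [show ((2 * q + 2) * (2 * q + 1) * ((2 * r + 2) * (2 * r + 1)) : ℝ) *
        (((2 * q).choose (q + j + 1) : ℝ) * (2 * r).choose (r + j + 1)) =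
        ((2 * q + 2) * (2 * q + 1) * (2 * q).choose (q + j + 1)) *
        ((2 * r + 2) * (2 * r + 1) * (2 * r).choose (r + j + 1)) by ring, ← h1, ← h2]
    linear_combination -(((q : ℝ) + 1) ^ 2 + ((r : ℝ) + 1) ^ 2) *
      ((2 * (r + 1)).choose (r + 1 + j + 1) : ℝ) * h1
  rw [hsplit, key q r (by omega) (by omega), key q (r + 1) (by omega) hr,
    key (q + 1) (r + 1) hq hr, show q + 1 + (r + 1) = q + r + 1 + 1 by ring,
    show q + (r + 1) = q + r + 1 by ring, centralBinom_succ_cast (q + r + 1),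
    centralBinom_succ_cast (q + r), centralBinom_succ_cast q, centralBinom_succ_cast r]
  push_cast
  field_simp
  ring

open Finset in
/-- Closed form of the ratio inside the logarithm of the pressure at the critical point. -/
theorem Zstar_two_div_Cst_two (q r : ℕ) :
    Zstar (q + r) q 2 / Cst (q + r) 0 2 =
      ((q + 1).centralBinom : ℝ) * (r + 1).centralBinom / (q + r + 1).centralBinom *
        ((3 * (q + 1) * (r + 1) - (q + r + 2)) / (2 * (2 * q + 1) * (2 * r + 1))) := by
  have hz : Zstar (q + r) q 2 = ((q + 1).centralBinom : ℝ) * (r + 1).centralBinom /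
      ((2 * q + 1) * (2 * q + 2) * ((2 * r + 1) * (2 * r + 2))) *
      ∑ j ∈ range (q + r + 1), ((j : ℝ) + 1) ^ 4 * (2 * (q + 1)).choose (q + 1 + j + 1) *
        (2 * (r + 1)).choose (r + 1 + j + 1) := by
    rw [Zstar, mul_sum]
    refine sum_congr rfl fun j _ => ?_
    rw [Nat.add_sub_cancel_left, Cst_two, Cst_two, Nat.centralBinom, Nat.centralBinom,
      show q + 1 + j + 1 = q + j + 2 by ring, show r + 1 + j + 1 = r + j + 2 by ring,
      mul_add 2 q 1, mul_add 2 r 1, mul_one]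
    field_simp
  have hc : Cst (q + r) 0 2 = ((q + r + 1).centralBinom : ℝ) ^ 2 /
      (2 * (2 * (q + r) + 1) * (q + r + 2)) := by
    have h := choose_absorb (q + r) 0
    have h' : (((2 * (q + r) + 2).choose (q + r + 0 + 2) : ℕ) : ℝ) =
        (q + r + 1) / (q + r + 2) * (q + r + 1).centralBinom := by
      rw [Nat.centralBinom, mul_add 2 (q + r) 1, mul_one]
      push_cast at h
      field_simp
      linear_combination h
    rw [Cst_two, h', Nat.centralBinom, mul_add 2 (q + r) 1, mul_one]
    push_cast
    field_simp
    ring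
  have hpos : ((q + r).centralBinom : ℝ) ≠ 0 := by
    exact_mod_cast (Nat.centralBinom_pos _).ne'
  rw [hz, hc, sum_pow_four_mul_choose_mul_choose q r _ (by omega) (by omega)]
  rw [centralBinom_succ_cast (q + r)]
  push_cast
  field_simp

/-- The central binomial coefficient satisfies `C(2n,n) √n / 4^n → 1/√π`. -/
theorem tendsto_centralBinom_mul_sqrt_div :
    Tendsto (fun n : ℕ => (n.centralBinom : ℝ) * √n / 4 ^ n) atTop (nhds (1 / √π)) := by
  have h := Stirling.tendsto_stirlingSeq_sqrt_pi
  have h2 : Tendsto (fun n : ℕ => 2 * n) atTop atTop :=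
    tendsto_id.const_mul_atTop' (by norm_num)
  have hπ : √π ≠ 0 := by positivity
  have hlim := (h.comp h2).div (h.pow 2) (pow_ne_zero 2 hπ)
  rw [show √π / √π ^ 2 = 1 / √π by field_simp] at hlim
  refine hlim.congr' ?_
  filter_upwards [eventually_gt_atTop 0] with n hn
  have hn' : (0 : ℝ) < n := by exact_mod_cast hn
  have hfac : ((2 * n).factorial : ℝ) = n.centralBinom * (n.factorial : ℝ) ^ 2 := by
    have := Nat.choose_mul_factorial_mul_factorial (show n ≤ 2 * n by omega)
    rw [show 2 * n - n = n by omega] at this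
    rw [← this, Nat.centralBinom]
    push_cast
    ring
  have hs : √(2 * ((2 * n : ℕ) : ℝ)) = 2 * √n := by
    rw [show 2 * ((2 * n : ℕ) : ℝ) = 2 ^ 2 * n by push_cast; ring, sqrt_mul (by positivity),
      sqrt_sq (by norm_num)]
  have hs2 : √(2 * (n : ℝ)) ^ 2 = 2 * (√n * √n) := by
    rw [sq_sqrt (by positivity), mul_self_sqrt hn'.le]
  simp only [Function.comp, Pi.div_apply, Stirling.stirlingSeq]
  have hp : (((2 * n : ℕ) : ℝ) / exp 1) ^ (2 * n) = 4 ^ n * (((n : ℝ) / exp 1) ^ n) ^ 2 := by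
    rw [← pow_mul, mul_comm n 2, show (4 : ℝ) ^ n = 2 ^ (2 * n) by rw [pow_mul]; norm_num,
      ← mul_pow]
    push_cast
    ring
  rw [hs, hfac, hp, div_pow (n.factorial : ℝ), mul_pow _ (((n : ℝ) / exp 1) ^ n), hs2]
  have : (n.factorial : ℝ) ≠ 0 := by positivity
  have : √(n : ℝ) ≠ 0 := by positivity
  field_simp

/-- If `b → ∞` and `b x → c` then `b log (1 - x) → -c`. -/
theorem tendsto_mul_log_one_sub {α : Type*} {l : Filter α} {b x : α → ℝ} {c : ℝ}
    (hb : Tendsto b l atTop) (h : Tendsto (fun i => b i * x i) l (nhds c)) :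
    Tendsto (fun i => b i * log (1 - x i)) l (nhds (-c)) := by
  have hx : Tendsto x l (nhds 0) := by
    have := h.mul (tendsto_inv_atTop_zero.comp hb)
    rw [mul_zero] at this
    refine this.congr' ?_
    filter_upwards [hb.eventually_gt_atTop 0] with i hi
    simp only [Function.comp]
    field_simp
  have hlow : Tendsto (fun i => -(b i * x i) / (1 - x i)) l (nhds (-c)) := by
    simpa [Pi.div_def] using h.neg.div (tendsto_const_nhds.sub hx) (by norm_num : (1 : ℝ) - 0 ≠ 0)
  refine tendsto_of_tendsto_of_tendsto_of_le_of_le' hlow h.neg ?_ ?_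
  · filter_upwards [hb.eventually_gt_atTop 0, hx.eventually_lt_const one_pos] with i hi hi1
    have h1 : 0 < 1 - x i := by linarith
    calc -(b i * x i) / (1 - x i) = b i * (1 - (1 - x i)⁻¹) := by field_simp; ring
      _ ≤ b i * log (1 - x i) :=
        mul_le_mul_of_nonneg_left (one_sub_inv_le_log_of_pos h1) hi.le
  · filter_upwards [hb.eventually_gt_atTop 0, hx.eventually_lt_const one_pos] with i hi hi1
    have h1 : 0 < 1 - x i := by linarith
    calc b i * log (1 - x i) ≤ b i * (1 - x i - 1) :=
        mul_le_mul_of_nonneg_left (log_le_sub_one_of_pos h1) hi.le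
      _ = -(b i * x i) := by ring

theorem sqrt_mul_Zstar_two_div_Cst_two (q r : ℕ) :
    √((q + r : ℕ) : ℝ) * (Zstar (q + r) q 2 / Cst (q + r) 0 2) =
      ((q + 1).centralBinom * √((q + 1 : ℕ) : ℝ) / 4 ^ (q + 1)) *
        ((r + 1).centralBinom * √((r + 1 : ℕ) : ℝ) / 4 ^ (r + 1)) /
        ((q + r + 1).centralBinom * √((q + r + 1 : ℕ) : ℝ) / 4 ^ (q + r + 1)) * 4 *
        √(((q + r : ℕ) : ℝ) * (q + r + 1 : ℕ) / ((q + 1 : ℕ) * (r + 1 : ℕ))) *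
        ((3 * (q + 1) * (r + 1) - (q + r + 2)) / (2 * (2 * q + 1) * (2 * r + 1))) := by
  have hpos : ((q + r + 1).centralBinom : ℝ) ≠ 0 := by
    exact_mod_cast (Nat.centralBinom_pos _).ne'
  have h1 : √((q + 1 : ℕ) : ℝ) ≠ 0 := by positivity
  have h2 : √((r + 1 : ℕ) : ℝ) ≠ 0 := by positivity
  have h3 : √((q + r + 1 : ℕ) : ℝ) ≠ 0 := by positivity
  rw [Zstar_two_div_Cst_two, sqrt_div (by positivity), sqrt_mul (by positivity),
    sqrt_mul (by positivity)]
  generalize √((q + 1 : ℕ) : ℝ) = s1 at *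
  generalize √((r + 1 : ℕ) : ℝ) = s2 at *
  generalize √((q + r + 1 : ℕ) : ℝ) = s3 at *
  field_simp
  ring

theorem tendsto_sqrt_mul_Zstar_two_div_Cst_two {a : ℝ} (ha0 : 0 < a) (ha1 : a < 1) {q : ℕ → ℕ}
    (hq : ∀ n, q n ≤ n) (hlim : Tendsto (fun n => (q n : ℝ) / n) atTop (nhds a)) :
    Tendsto (fun n : ℕ => √(n : ℝ) * (Zstar n (q n) 2 / Cst n 0 2)) atTop
      (nhds (3 / (2 * √(π * a * (1 - a))))) := by
  have hb : 0 < 1 - a := by linarith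
  have hrlim : Tendsto (fun n => ((n - q n : ℕ) : ℝ) / n) atTop (nhds (1 - a)) := by
    refine (tendsto_const_nhds.sub hlim).congr' ?_
    filter_upwards [eventually_gt_atTop 0] with n hn
    have hn' : (n : ℝ) ≠ 0 := by exact_mod_cast hn.ne'
    rw [Nat.cast_sub (hq n)]
    field_simp
  have htop {c : ℝ} (hc : 0 < c) {p : ℕ → ℕ}
      (hp : Tendsto (fun n => (p n : ℝ) / n) atTop (nhds c)) : Tendsto p atTop atTop := by
    rw [← tendsto_natCast_atTop_iff (R := ℝ)]
    refine (hp.pos_mul_atTop hc tendsto_natCast_atTop_atTop).congr' ?_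
    filter_upwards [eventually_gt_atTop 0] with n hn
    have hn' : (n : ℝ) ≠ 0 := by exact_mod_cast hn.ne'
    field_simp
  have hinv : Tendsto (fun n : ℕ => 1 / (n : ℝ)) atTop (nhds 0) := tendsto_one_div_atTop_nhds_zero_nat
  have hw := tendsto_centralBinom_mul_sqrt_div
  have hw1 := hw.comp (tendsto_add_atTop_nat 1)
  have hqt := htop ha0 hlim
  have hrt := htop hb hrlim
  have hπ : √π ≠ 0 := by positivity
  have hsq : Tendsto (fun n : ℕ => √((n : ℝ) * (n + 1 : ℕ) / ((q n + 1 : ℕ) * (n - q n + 1 : ℕ))))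
      atTop (nhds √(1 / (a * (1 - a)))) := by
    refine (continuous_sqrt.tendsto _).comp ?_
    have h := (hinv.const_add 1).div ((hlim.add hinv).mul (hrlim.add hinv))
      (by rw [add_zero, add_zero]; positivity)
    simp only [add_zero] at h
    refine h.congr' ?_
    filter_upwards [eventually_gt_atTop 0] with n hn
    have hn' : (n : ℝ) ≠ 0 := by exact_mod_cast hn.ne'
    simp only [Pi.div_apply]
    push_cast
    field_simp
  have hrat : Tendsto (fun n : ℕ => (3 * ((q n : ℝ) + 1) * ((n - q n : ℕ) + 1) -
      (q n + (n - q n : ℕ) + 2)) / (2 * (2 * q n + 1) * (2 * (n - q n : ℕ) + 1))) atTop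
      (nhds (3 / 8)) := by
    have hqi := hinv.comp hqt
    have hri := hinv.comp hrt
    have h := ((((hqi.const_add 1).const_mul 3).mul (hri.const_add 1)).sub
      ((hqi.mul (hri.const_add 1)).add (hri.mul (hqi.const_add 1)))).div
      (((hqi.const_add 2).const_mul 2).mul (hri.const_add 2)) (by norm_num)
    norm_num at h
    refine h.congr' ?_
    filter_upwards [hqt.eventually_gt_atTop 0, hrt.eventually_gt_atTop 0] with n h1 h2
    have h1' : (q n : ℝ) ≠ 0 := by exact_mod_cast h1.ne'
    have h2' : ((n - q n : ℕ) : ℝ) ≠ 0 := by exact_mod_cast h2.ne'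
    simp only [Pi.div_apply]
    field_simp
    ring
  have hmain := (((((hw1.comp hqt).mul (hw1.comp hrt)).div hw1 (by positivity)).mul_const 4).mul
    hsq).mul hrat
  have hval : 1 / √π * (1 / √π) / (1 / √π) * 4 * √(1 / (a * (1 - a))) * (3 / 8) =
      3 / (2 * √(π * a * (1 - a))) := by
    rw [mul_assoc π, sqrt_mul pi_pos.le, sqrt_div zero_le_one, sqrt_one]
    have : √(a * (1 - a)) ≠ 0 := by positivity
    field_simp
    norm_num
  rw [hval] at hmain
  refine hmain.congr fun n => ?_
  have h := sqrt_mul_Zstar_two_div_Cst_two (q n) (n - q n)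
  rw [Nat.add_sub_cancel' (hq n)] at h
  rw [h]
  rfl

theorem tendsto_two_mul_floor_half_div {a : ℝ} (ha : 0 ≤ a) :
    Tendsto (fun n : ℕ => ((2 * ⌊a * (n : ℝ) / 2⌋₊ : ℕ) : ℝ) / n) atTop (nhds a) := by
  have h := ((tendsto_nat_floor_mul_div_atTop (show 0 ≤ a / 2 by positivity)).comp
    tendsto_natCast_atTop_atTop).const_mul 2
  rw [show 2 * (a / 2) = a by ring] at h
  refine h.congr fun n => ?_
  simp only [Function.comp]
  rw [show a / 2 * (n : ℝ) = a * n / 2 by ring]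
  push_cast
  ring

/-- At the critical point `z = 2`, for `a ∈ (0,1)`,
`lim_{n→∞} √n · P_n^S(2; 2⌊an/2⌋) = −3/(2√(π·a·(1−a)))`; in particular the pressure
itself tends to `0`. -/
theorem staircase_pressure_critical (a : ℝ) (ha0 : 0 < a) (ha1 : a < 1) :
    Tendsto (fun n : ℕ => Real.sqrt (n : ℝ) * PS n (2 * ⌊a * (n : ℝ) / 2⌋₊) 2) atTop
      (nhds (-(3 / (2 * Real.sqrt (π * a * (1 - a)))))) ∧
    Tendsto (fun n : ℕ => PS n (2 * ⌊a * (n : ℝ) / 2⌋₊) 2) atTop (nhds 0) := by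
  have hq (n : ℕ) : 2 * ⌊a * (n : ℝ) / 2⌋₊ ≤ n := by
    have h1 : (⌊a * (n : ℝ) / 2⌋₊ : ℝ) ≤ a * n / 2 := Nat.floor_le (by positivity)
    have h2 : a * (n : ℝ) ≤ n := mul_le_of_le_one_left (Nat.cast_nonneg n) ha1.le
    have h3 : 2 * (⌊a * (n : ℝ) / 2⌋₊ : ℝ) ≤ n := by linarith
    exact_mod_cast h3
  have hsqrt : Tendsto (fun n : ℕ => √(n : ℝ)) atTop atTop :=
    tendsto_sqrt_atTop.comp tendsto_natCast_atTop_atTop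
  have h1 := tendsto_mul_log_one_sub hsqrt
    (tendsto_sqrt_mul_Zstar_two_div_Cst_two ha0 ha1 hq (tendsto_two_mul_floor_half_div ha0.le))
  refine ⟨h1, ?_⟩
  have h2 := h1.mul (tendsto_inv_atTop_zero.comp hsqrt)
  rw [mul_zero] at h2
  refine h2.congr' ?_
  filter_upwards [hsqrt.eventually_gt_atTop 0] with n hn
  simp only [Function.comp, PS]
  field_simp
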